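/- arXiv:1801.08664 — 2 statements merged into one kernel-verified Lean document; each statement's English description precedes it below -/
import Mathlib

section
/- For every τ with 0 ≤ τ < N, the cross-correlation of u′ and v satisfies: R_{u′,v}(τ) = 3 if τ ∈ D_1, and R_{u′,v}(τ) = −1 otherwise. -/
open Finset Polynomial

def corr (n : ℕ) (a b : ℤ → ℕ) (τ : ℤ) : ℤ :=
  ∑ i ∈ Finset.range n, (-1 : ℤ) ^ (a i + b ((i : ℤ) + τ))

def Dclass (N f : ℕ) (β : ZMod N) (j : ℕ) : Set (ZMod N) :=
  {x | ∃ k < f, x = β ^ (4 * k + j)}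

open Classical in
/-- The binary sequence of period `N` whose characteristic set is `S ⊆ Z_N`. -/
noncomputable def chiSeq (N : ℕ) (S : Set (ZMod N)) : ℤ → ℕ :=
  fun t => if (t : ZMod N) ∈ S then 1 else 0

/-- A prime of the form `c ^ 2 + 1` with `c` even is the sum of an odd and an even square in only
one way. -/
theorem sq_eq_one_of_sq_add_sq_eq_prime {p : ℕ} (hp : p.Prime) {a b c : ℤ}
    (hc : Even c) (ha : Odd a) (hpc : (p : ℤ) = c ^ 2 + 1) (hab : a ^ 2 + b ^ 2 = p) :
    a ^ 2 = 1 := by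
  have key : ∀ b : ℤ, a ^ 2 + b ^ 2 = p → (p : ℤ) ∣ a * c - b → a ^ 2 = 1 := by
    intro b hab ⟨q, hq⟩
    have hp0 : (0 : ℤ) < p := by exact_mod_cast hp.pos
    have hsq : (p * q) ^ 2 + (a + b * c) ^ 2 = (p : ℤ) ^ 2 := by
      rw [← hq]
      calc (a * c - b) ^ 2 + (a + b * c) ^ 2 = (a ^ 2 + b ^ 2) * (c ^ 2 + 1) := by ring
        _ = _ := by rw [hab, ← hpc]; ring
    have hq1 : q ^ 2 ≤ 1 := by
      by_contra! h
      nlinarith [sq_nonneg (a + b * c), mul_pos hp0 hp0]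
    rcases eq_or_ne q 0 with rfl | hq0
    · have hb : b = a * c := by linarith
      have : a ^ 2 * p = 1 * p := by rw [hb] at hab; linear_combination a ^ 2 * hpc + hab
      exact mul_right_cancel₀ hp0.ne' this
    · have hq2 : q ^ 2 = 1 := le_antisymm hq1 (by have := sq_pos_of_ne_zero hq0; omega)
      have h0 : a + b * c = 0 := by
        have : (a + b * c) ^ 2 = 0 := by linear_combination hsq - p ^ 2 * hq2
        exact pow_eq_zero_iff two_ne_zero |>.1 this
      have ha' : Even a := by
        rw [show a = -(b * c) by linarith]
        exact (hc.mul_left b).neg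
      exact absurd ha (Int.not_odd_iff_even.2 ha')
  have hdvd : (p : ℤ) ∣ (a * c - b) * (a * c + b) :=
    ⟨a ^ 2 - 1, by linear_combination -hab - a ^ 2 * hpc⟩
  rcases (Nat.prime_iff_prime_int.1 hp).dvd_or_dvd hdvd with h | h
  · exact key b hab h
  · exact key (-b) (by simpa using hab) (by simpa using h)

theorem GaussianInt.mul_star_eq_one_of_isUnit {z : GaussianInt} (hz : IsUnit z) :
    z * star z = 1 := by
  rw [← Zsqrtd.norm_eq_mul_conj, (Zsqrtd.norm_eq_one_iff' (by norm_num) z).2 hz, Int.cast_one]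

theorem MulChar.inv_apply_eq_star {F : Type*} [Field F] (χ : MulChar F GaussianInt) (x : F) :
    χ⁻¹ x = star (χ x) := by
  by_cases hx : IsUnit x
  · have h := hx.map χ
    apply h.mul_left_cancel
    rw [GaussianInt.mul_star_eq_one_of_isUnit h, mul_comm, ← MulChar.mul_apply, inv_mul_cancel,
      MulChar.one_apply hx]
  · rw [MulChar.map_nonunit _ hx, MulChar.map_nonunit _ hx, star_zero]

theorem norm_jacobiSum_self {F : Type*} [Field F] [Fintype F] (χ : MulChar F GaussianInt)
    (hχ : χ * χ ≠ 1) : (jacobiSum χ χ).norm = Fintype.card F := by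
  have hinj := GaussianInt.toComplex_injective
  have hχ2 : χ.ringHomComp GaussianInt.toComplex * χ.ringHomComp GaussianInt.toComplex ≠ 1 := by
    rw [← MulChar.ringHomComp_mul]
    exact (MulChar.ringHomComp_ne_one_iff hinj).2 hχ
  have hχ1 : χ.ringHomComp GaussianInt.toComplex ≠ 1 := by
    intro h
    exact hχ2 (by rw [h, one_mul])
  have hchar : ringChar ℂ ≠ ringChar F := by
    rw [ringChar.eq_zero]
    exact (CharP.ringChar_ne_zero_of_finite F).symm
  have h := jacobiSum_mul_jacobiSum_inv hchar hχ1 hχ1 hχ2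
  rw [MulChar.ringHomComp_inv, jacobiSum_ringHomComp, jacobiSum_ringHomComp, ← map_mul,
    ← map_natCast GaussianInt.toComplex] at h
  have hstar : jacobiSum χ⁻¹ χ⁻¹ = star (jacobiSum χ χ) := by
    simp only [jacobiSum, MulChar.inv_apply_eq_star, star_sum, star_mul']
  have h' := hinj h
  rw [hstar, ← Zsqrtd.norm_eq_mul_conj] at h'
  exact_mod_cast h'

theorem sum_mulChar_mul_mulChar_add {F R : Type*} [Field F] [Fintype F] [CommRing R]
    (χ : MulChar F R) {a : F} (ha : a ≠ 0) :
    ∑ x, χ x * χ (x + a) = χ (-1) * χ a ^ 2 * jacobiSum χ χ := by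
  rw [jacobiSum, Finset.mul_sum, ← Equiv.sum_comp (Equiv.mulLeft₀ (-a) (neg_ne_zero.2 ha))]
  refine Finset.sum_congr rfl fun x _ => ?_
  simp only [Equiv.mulLeft₀_apply]
  rw [show -a * x + a = a * (1 - x) by ring, show -a * x = -1 * a * x by ring]
  simp only [map_mul]
  ring

theorem im_sum_mulChar_mul_star_add {F : Type*} [Field F] [Fintype F]
    (χ : MulChar F GaussianInt) (hχ : χ (-1) * χ (-1) = 1) (a : F) :
    (∑ x, χ x * star (χ (x + a))).im = 0 := by
  have h : star (∑ x, χ x * star (χ (x + a))) = ∑ x, χ x * star (χ (x + a)) := by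
    conv_lhs => rw [← Equiv.sum_comp ((Equiv.addRight a).trans (Equiv.neg F)), star_sum]
    refine Finset.sum_congr rfl fun x _ => ?_
    have e : χ (-1) * star (χ (-1)) = 1 :=
      GaussianInt.mul_star_eq_one_of_isUnit (IsUnit.of_mul_eq_one _ hχ)
    simp only [Equiv.trans_apply, Equiv.coe_addRight, Equiv.neg_apply]
    rw [show -(x + a) + a = -1 * x by ring, show -(x + a) = -1 * (x + a) by ring]
    simp only [map_mul, star_mul', star_star]
    linear_combination (χ x * star (χ (x + a))) * e
  have := congrArg Zsqrtd.im h
  rw [Zsqrtd.im_star] at this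
  omega

theorem sum_range_natCast_zmod {M : Type*} [AddCommMonoid M] (n : ℕ) [NeZero n] (g : ZMod n → M) :
    ∑ i ∈ Finset.range n, g (i : ZMod n) = ∑ x, g x := by
  refine Finset.sum_bij' (fun i _ => (i : ZMod n)) (fun x _ => x.val) ?_ ?_ ?_ ?_ ?_
  · simp
  · intro x _
    simpa using ZMod.val_lt x
  · intro i hi
    exact ZMod.val_cast_of_lt (Finset.mem_range.1 hi)
  · simp
  · simp

theorem exists_pow_lt_of_orderOf_eq {N : ℕ} [Fact N.Prime] {β : ZMod N} (hβ : orderOf β = N - 1)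
    {t : ZMod N} (ht : t ≠ 0) : ∃ m < N - 1, t = β ^ m := by
  have : NeZero (N - 1) := ⟨by have := (Fact.out : N.Prime).two_le; omega⟩
  have hprim : IsPrimitiveRoot β (N - 1) := hβ ▸ IsPrimitiveRoot.orderOf β
  obtain ⟨m, hm, h⟩ := hprim.eq_pow_of_pow_eq_one (ZMod.pow_card_sub_one_eq_one ht)
  exact ⟨m, hm, h.symm⟩

/-- The quartic character sending the primitive root `β` to the Gaussian unit `i`. -/
theorem exists_mulChar_apply_primitiveRoot {N f : ℕ} [Fact N.Prime] (hNf : N = 4 * f + 1)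
    {β : ZMod N} (hβ : orderOf β = N - 1) :
    ∃ χ : MulChar (ZMod N) GaussianInt, χ β = ⟨0, 1⟩ := by
  have hN := (Fact.out : N.Prime).two_le
  have hβ0 : β ≠ 0 := by
    rintro rfl
    rw [orderOf_zero] at hβ
    omega
  let g : (ZMod N)ˣ := Units.mk0 β hβ0
  have hg : ∀ x, x ∈ Subgroup.zpowers g := by
    intro x
    obtain ⟨m, -, hm⟩ := exists_pow_lt_of_orderOf_eq hβ x.ne_zero
    exact ⟨m, by ext1; simp [g, hm]⟩
  let i : GaussianIntˣ := ⟨⟨0, 1⟩, ⟨0, -1⟩, by decide, by decide⟩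
  have hi : i ∈ rootsOfUnity (Fintype.card (ZMod N)ˣ) GaussianInt := by
    rw [mem_rootsOfUnity, ZMod.card_units, hNf, Nat.add_sub_cancel, pow_mul]
    have : i ^ 4 = 1 := by ext1; decide
    rw [this, one_pow]
  exact ⟨MulChar.ofRootOfUnity hi hg, MulChar.ofRootOfUnity_spec hi hg⟩

theorem gaussianInt_I_pow_mod (m : ℕ) : (⟨0, 1⟩ : GaussianInt) ^ m = ⟨0, 1⟩ ^ (m % 4) := by
  conv_lhs => rw [← Nat.div_add_mod m 4, pow_add, pow_mul]
  rw [show (⟨0, 1⟩ : GaussianInt) ^ 4 = 1 by decide, one_pow, one_mul]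

theorem mem_Dclass_iff {N f : ℕ} [Fact N.Prime] (hNf : N = 4 * f + 1) {β : ZMod N}
    (hβ : orderOf β = N - 1) {χ : MulChar (ZMod N) GaussianInt} (hχ : χ β = ⟨0, 1⟩)
    {j : ℕ} (hj : j < 4) (t : ZMod N) : t ∈ Dclass N f β j ↔ χ t = ⟨0, 1⟩ ^ j := by
  constructor
  · rintro ⟨k, -, rfl⟩
    rw [map_pow, hχ, gaussianInt_I_pow_mod, show (4 * k + j) % 4 = j by omega]
  · intro h
    have ht : t ≠ 0 := by
      rintro rfl
      rw [MulChar.map_zero] at h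
      interval_cases j <;> revert h <;> decide
    obtain ⟨m, hm, rfl⟩ := exists_pow_lt_of_orderOf_eq hβ ht
    rw [map_pow, hχ, gaussianInt_I_pow_mod] at h
    have hinj : ∀ a < 4, ∀ b < 4, (⟨0, 1⟩ : GaussianInt) ^ a = ⟨0, 1⟩ ^ b → a = b := by decide
    have := hinj _ (Nat.mod_lt m (by norm_num)) j hj h
    exact ⟨m / 4, by omega, by congr 1; omega⟩

theorem exists_mulChar_apply_eq_pow {N : ℕ} [Fact N.Prime] {β : ZMod N}
    (hβ : orderOf β = N - 1) {χ : MulChar (ZMod N) GaussianInt} (hχ : χ β = ⟨0, 1⟩)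
    {t : ZMod N} (ht : t ≠ 0) : ∃ j < 4, χ t = ⟨0, 1⟩ ^ j := by
  obtain ⟨m, -, rfl⟩ := exists_pow_lt_of_orderOf_eq hβ ht
  exact ⟨m % 4, Nat.mod_lt _ (by norm_num), by rw [map_pow, hχ, gaussianInt_I_pow_mod]⟩

theorem mulChar_neg_one_eq {N f : ℕ} [Fact N.Prime] (hNf : N = 4 * f + 1) (hf : Odd f)
    {β : ZMod N} (hβ : orderOf β = N - 1) {χ : MulChar (ZMod N) GaussianInt}
    (hχ : χ β = ⟨0, 1⟩) : χ (-1) = -1 := by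
  have hf0 := hf.pos
  have h1 : (β ^ (2 * f)) ^ 2 = 1 := by
    rw [← pow_mul, show 2 * f * 2 = N - 1 by omega, ← hβ, pow_orderOf_eq_one]
  have h2 : β ^ (2 * f) ≠ 1 := pow_ne_one_of_lt_orderOf (by omega) (by omega)
  rw [← (sq_eq_one_iff.1 h1).resolve_left h2, map_pow, hχ, pow_mul,
    show (⟨0, 1⟩ : GaussianInt) ^ 2 = -1 by decide, hf.neg_one_pow]

theorem neg_one_pow_chiSeq (N : ℕ) (S : Set (ZMod N)) [DecidablePred (· ∈ S)] (t : ℤ) :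
    (-1 : ℤ) ^ chiSeq N S t = if (t : ZMod N) ∈ S then -1 else 1 := by
  unfold chiSeq
  split_ifs <;> simp

theorem neg_one_pow_chiSeq_zero_union {N f : ℕ} [Fact N.Prime] (hNf : N = 4 * f + 1)
    {β : ZMod N} (hβ : orderOf β = N - 1) {χ : MulChar (ZMod N) GaussianInt}
    (hχ : χ β = ⟨0, 1⟩) (t : ℤ) :
    (-1 : ℤ) ^ chiSeq N ({0} ∪ Dclass N f β 0 ∪ Dclass N f β 1) t =
      -((χ t).re + (χ t).im) - if (t : ZMod N) = 0 then 1 else 0 := by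
  classical
  rw [neg_one_pow_chiSeq]
  simp only [Set.mem_union, Set.mem_singleton_iff,
    mem_Dclass_iff hNf hβ hχ (by norm_num : 0 < 4), mem_Dclass_iff hNf hβ hχ (by norm_num : 1 < 4)]
  by_cases h : (t : ZMod N) = 0
  · simp only [h, MulChar.map_zero]
    decide
  · obtain ⟨j, hj, hjt⟩ := exists_mulChar_apply_eq_pow hβ hχ h
    simp only [h, hjt, false_or, if_false]
    interval_cases j <;> decide

theorem neg_one_pow_chiSeq_union {N f : ℕ} [Fact N.Prime] (hNf : N = 4 * f + 1)
    {β : ZMod N} (hβ : orderOf β = N - 1) {χ : MulChar (ZMod N) GaussianInt}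
    (hχ : χ β = ⟨0, 1⟩) (t : ℤ) :
    (-1 : ℤ) ^ chiSeq N (Dclass N f β 1 ∪ Dclass N f β 2) t =
      ((χ t).re - (χ t).im) + if (t : ZMod N) = 0 then 1 else 0 := by
  classical
  rw [neg_one_pow_chiSeq]
  simp only [Set.mem_union,
    mem_Dclass_iff hNf hβ hχ (by norm_num : 1 < 4), mem_Dclass_iff hNf hβ hχ (by norm_num : 2 < 4)]
  by_cases h : (t : ZMod N) = 0
  · simp only [h, MulChar.map_zero]
    decide
  · obtain ⟨j, hj, hjt⟩ := exists_mulChar_apply_eq_pow hβ hχ h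
    simp only [h, hjt, if_false]
    interval_cases j <;> decide

theorem mulChar_mul_self_ne_one {F : Type*} [Field F] {χ : MulChar F GaussianInt} {b : F}
    (hχ : χ b = ⟨0, 1⟩) : χ * χ ≠ 1 := by
  intro h
  have hb : b ≠ 0 := by
    rintro rfl
    rw [MulChar.map_zero] at hχ
    revert hχ
    decide
  have h' : (χ * χ) b = 1 := by rw [h, MulChar.one_apply hb.isUnit]
  rw [MulChar.mul_apply, hχ] at h'
  revert h'
  decide

theorem gaussianInt_re_sum {ι : Type*} (s : Finset ι) (g : ι → GaussianInt) :
    (∑ x ∈ s, g x).re = ∑ x ∈ s, (g x).re :=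
  map_sum (AddMonoidHom.mk' Zsqrtd.re Zsqrtd.re_add : GaussianInt →+ ℤ) g s

theorem gaussianInt_im_sum {ι : Type*} (s : Finset ι) (g : ι → GaussianInt) :
    (∑ x ∈ s, g x).im = ∑ x ∈ s, (g x).im :=
  map_sum (AddMonoidHom.mk' Zsqrtd.im Zsqrtd.im_add : GaussianInt →+ ℤ) g s

theorem corr_eq_mulChar {N f : ℕ} [Fact N.Prime] (hNf : N = 4 * f + 1) (hf : Odd f)
    {β : ZMod N} (hβ : orderOf β = N - 1) {χ : MulChar (ZMod N) GaussianInt}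
    (hχ : χ β = ⟨0, 1⟩) (τ : ℤ) :
    corr N (chiSeq N ({0} ∪ Dclass N f β 0 ∪ Dclass N f β 1))
        (chiSeq N (Dclass N f β 1 ∪ Dclass N f β 2)) τ =
      -(∑ x, χ x * χ (x + τ)).re + 2 * (χ τ).im - if (τ : ZMod N) = 0 then 1 else 0 := by
  have hneg := mulChar_neg_one_eq hNf hf hβ hχ
  have him := im_sum_mulChar_mul_star_add χ (by rw [hneg]; norm_num) τ
  have hχneg : χ (-τ) = -χ τ := by rw [← neg_one_mul (τ : ZMod N), map_mul, hneg, neg_one_mul]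
  calc _ = ∑ x : ZMod N, (-((χ x).re + (χ x).im) - if x = 0 then 1 else 0) *
        ((χ (x + τ)).re - (χ (x + τ)).im + if x + τ = 0 then 1 else 0) := by
        rw [← sum_range_natCast_zmod]
        refine Finset.sum_congr rfl fun i _ => ?_
        rw [pow_add, neg_one_pow_chiSeq_zero_union hNf hβ hχ, neg_one_pow_chiSeq_union hNf hβ hχ]
        push_cast
        rfl
    _ = ∑ x : ZMod N, (-(χ x * χ (x + τ)).re - (χ x * star (χ (x + τ))).im
          - (if x = -τ then (χ x).re + (χ x).im else 0)
          - (if x = 0 then (χ (x + τ)).re - (χ (x + τ)).im +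
              (if x + τ = 0 then 1 else 0) else 0)) := by
        refine Finset.sum_congr rfl fun x _ => ?_
        simp only [Zsqrtd.re_mul, Zsqrtd.im_mul, Zsqrtd.re_star, Zsqrtd.im_star,
          add_eq_zero_iff_eq_neg]
        split_ifs <;> ring
    _ = -(∑ x, χ x * χ (x + τ)).re - (∑ x, χ x * star (χ (x + τ))).im
          - ((χ (-τ)).re + (χ (-τ)).im)
          - ((χ τ).re - (χ τ).im + (if (τ : ZMod N) = 0 then 1 else 0)) := by
        simp only [Finset.sum_sub_distrib, Finset.sum_neg_distrib, Finset.sum_ite_eq',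
          Finset.mem_univ, if_true, zero_add, gaussianInt_re_sum, gaussianInt_im_sum]
    _ = _ := by
        rw [him, hχneg, Zsqrtd.re_neg, Zsqrtd.im_neg]
        ring

theorem corr_emod_four {N f : ℕ} [Fact N.Prime] (hNf : N = 4 * f + 1)
    {β : ZMod N} (hβ : orderOf β = N - 1) {χ : MulChar (ZMod N) GaussianInt}
    (hχ : χ β = ⟨0, 1⟩) (τ : ℤ) :
    corr N (chiSeq N ({0} ∪ Dclass N f β 0 ∪ Dclass N f β 1))
        (chiSeq N (Dclass N f β 1 ∪ Dclass N f β 2)) τ % 4 = 3 := by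
  set a := chiSeq N ({0} ∪ Dclass N f β 0 ∪ Dclass N f β 1) with ha
  set b := chiSeq N (Dclass N f β 1 ∪ Dclass N f β 2) with hb
  have hχ1 : χ ≠ 1 := by
    rintro rfl
    exact mulChar_mul_self_ne_one hχ (one_mul 1)
  have hsum := MulChar.sum_eq_zero_of_ne_one hχ1
  have hre := congrArg Zsqrtd.re hsum
  have him := congrArg Zsqrtd.im hsum
  rw [gaussianInt_re_sum, Zsqrtd.re_zero] at hre
  rw [gaussianInt_im_sum, Zsqrtd.im_zero] at him
  have hA : ∑ i ∈ Finset.range N, (-1 : ℤ) ^ a i = -1 := by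
    simp only [ha, neg_one_pow_chiSeq_zero_union hNf hβ hχ, Int.cast_natCast]
    rw [sum_range_natCast_zmod N fun x : ZMod N =>
      -((χ x).re + (χ x).im) - if x = 0 then (1 : ℤ) else 0]
    simp [Finset.sum_add_distrib, hre, him]
  have hB : ∑ i ∈ Finset.range N, (-1 : ℤ) ^ b (i + τ) = 1 := by
    simp only [hb, neg_one_pow_chiSeq_union hNf hβ hχ, Int.cast_natCast, Int.cast_add]
    rw [sum_range_natCast_zmod N fun x : ZMod N =>
      (χ (x + τ)).re - (χ (x + τ)).im + if x + τ = 0 then (1 : ℤ) else 0]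
    refine (Equiv.sum_comp (Equiv.addRight (τ : ZMod N)) fun x : ZMod N =>
      (χ x).re - (χ x).im + if x = 0 then (1 : ℤ) else 0).trans ?_
    simp [Finset.sum_add_distrib, hre, him]
  have hdvd : (4 : ℤ) ∣ ∑ i ∈ Finset.range N,
      ((-1 : ℤ) ^ (a i + b (i + τ)) - (-1) ^ a i - (-1) ^ b (i + τ) + 1) := by
    refine Finset.dvd_sum fun i _ => ?_
    rw [pow_add]
    rcases neg_one_pow_eq_or ℤ (a i) with h | h <;>
      rcases neg_one_pow_eq_or ℤ (b (i + τ)) with h' | h' <;> rw [h, h'] <;> norm_num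
  rw [Finset.sum_add_distrib, Finset.sum_sub_distrib, Finset.sum_sub_distrib, hA, hB] at hdvd
  simp only [Finset.sum_const, Finset.card_range, nsmul_eq_mul, mul_one] at hdvd
  unfold corr
  omega

/-- the cross-correlation `R_{u',v}`. -/
theorem stmt4 (N f y : ℕ) (hprime : N.Prime) (hNf : N = 4 * f + 1) (hN5 : 5 ≤ N)
    (hfy : f = y ^ 2) (hy : 0 < y) (hfodd : Odd f)
    (β : ZMod N) (hβ : orderOf β = N - 1)
    (u' v : ℤ → ℕ)
    (hu' : u' = chiSeq N ({0} ∪ Dclass N f β 0 ∪ Dclass N f β 1))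
    (hv : v = chiSeq N (Dclass N f β 1 ∪ Dclass N f β 2)) :
    ∀ τ : ℤ, 0 ≤ τ → τ < N →
      ((τ : ZMod N) ∈ Dclass N f β 1 → corr N u' v τ = 3) ∧
      ((τ : ZMod N) ∉ Dclass N f β 1 → corr N u' v τ = -1) := by
  intro τ _ _
  subst hu' hv
  have : Fact N.Prime := ⟨hprime⟩
  obtain ⟨χ, hχ⟩ := exists_mulChar_apply_primitiveRoot hNf hβ
  have hneg := mulChar_neg_one_eq hNf hfodd hβ hχ
  have hχ2 := mulChar_mul_self_ne_one hχ
  have hmod := corr_emod_four hNf hβ hχ τ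
  have hcorr := corr_eq_mulChar hNf hfodd hβ hχ τ
  set R := corr N (chiSeq N ({0} ∪ Dclass N f β 0 ∪ Dclass N f β 1))
    (chiSeq N (Dclass N f β 1 ∪ Dclass N f β 2)) τ
  rw [mem_Dclass_iff hNf hβ hχ (by norm_num : 1 < 4)]
  rcases eq_or_ne (τ : ZMod N) 0 with h0 | h0
  · have hS : ∑ x, χ x * χ (x + 0) = 0 := by
      simp only [add_zero, ← MulChar.mul_apply]
      exact MulChar.sum_eq_zero_of_ne_one hχ2
    rw [h0, hS, MulChar.map_zero] at hcorr
    rw [h0, MulChar.map_zero]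
    refine ⟨fun h => absurd h (by decide), fun _ => ?_⟩
    simpa using hcorr
  · rw [sum_mulChar_mul_mulChar_add χ h0, hneg, if_neg h0] at hcorr
    have hnorm := norm_jacobiSum_self χ hχ2
    rw [ZMod.card, Zsqrtd.norm_def] at hnorm
    set J := jacobiSum χ χ
    obtain ⟨j, hj, hjt⟩ := exists_mulChar_apply_eq_pow hβ hχ h0
    have hcases : (χ τ ^ 2 = 1 ∧ (χ τ).im = 0 ∧ χ τ ≠ ⟨0, 1⟩ ^ 1) ∨
        (χ τ ^ 2 = -1 ∧ (χ τ).im = 1 ∧ χ τ = ⟨0, 1⟩ ^ 1) ∨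
        (χ τ ^ 2 = -1 ∧ (χ τ).im = -1 ∧ χ τ ≠ ⟨0, 1⟩ ^ 1) := by
      rw [hjt]
      interval_cases j <;> decide
    have hR : (R = J.re ∧ χ τ ≠ ⟨0, 1⟩ ^ 1) ∨ (R = -J.re + 2 ∧ χ τ = ⟨0, 1⟩ ^ 1) ∨
        (R = -J.re - 2 ∧ χ τ ≠ ⟨0, 1⟩ ^ 1) := by
      rcases hcases with ⟨hsq, him, h⟩ | ⟨hsq, him, h⟩ | ⟨hsq, him, h⟩ <;> rw [hsq, him] at hcorr
      · exact .inl ⟨by simpa using hcorr, h⟩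
      · exact .inr (.inl ⟨by simpa using hcorr, h⟩)
      · exact .inr (.inr ⟨by simpa [sub_eq_add_neg] using hcorr, h⟩)
    have hJodd : Odd J.re := by
      rw [Int.odd_iff]
      omega
    have hJ : J.re ^ 2 = 1 := by
      refine sq_eq_one_of_sq_add_sq_eq_prime hprime (c := 2 * y) (b := J.im) (even_two_mul _)
        hJodd ?_ ?_
      · rw [hNf, hfy]; push_cast; ring
      · rw [← hnorm]; ring
    rcases sq_eq_one_iff.1 hJ with hJ1 | hJ1 <;>
      rcases hR with ⟨hR, h⟩ | ⟨hR, h⟩ | ⟨hR, h⟩ <;>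
      exact ⟨fun h' => by first | omega | exact absurd h' h,
        fun h' => by first | omega | exact absurd h h'⟩
end

section
/- Suppose 2 mod N ∉ D_0. Then gcd(S_{u′}(x), x^N − 1) = 1 in F_2[x]; equivalently, the minimal polynomial of u′ is x^N − 1 and the linear complexity of u′ is N. -/
open Finset Polynomial

/-- The sequence polynomial over F_2 of a sequence of period `n`. -/
noncomputable def Spoly (n : ℕ) (s : ℤ → ℕ) : Polynomial (ZMod 2) :=
  ∑ i ∈ Finset.range n, Polynomial.C ((s (i : ℤ) : ZMod 2)) * Polynomial.X ^ i
/-- A sum over residues `i < N` is a sum over `ZMod N`. -/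
theorem sum_range_eq_sum_zmod {M : Type*} [AddCommMonoid M] (N : ℕ) [NeZero N]
    (g : ZMod N → ℕ → M) :
    ∑ i ∈ Finset.range N, g (i : ZMod N) i = ∑ x : ZMod N, g x x.val := by
  refine Finset.sum_nbij' (fun i => (i : ZMod N)) ZMod.val ?_ ?_ ?_ ?_ ?_
  · simp
  · intro x _
    simpa using ZMod.val_lt x
  · intro i hi
    exact ZMod.val_cast_of_lt (Finset.mem_range.mp hi)
  · simp
  · intro i hi
    simp only [ZMod.val_cast_of_lt (Finset.mem_range.mp hi)]

theorem aeval_Spoly_chiSeq {K : Type*} [Field K] [Algebra (ZMod 2) K] (N : ℕ) [NeZero N]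
    (S : Set (ZMod N)) [DecidablePred (· ∈ S)] (α : K) :
    aeval α (Spoly N (chiSeq N S)) = ∑ x : ZMod N, (if x ∈ S then 1 else 0) * α ^ x.val := by
  rw [← sum_range_eq_sum_zmod N (fun x i => (if x ∈ S then (1 : K) else 0) * α ^ i)]
  simp only [Spoly, chiSeq, map_sum, map_mul, aeval_C, map_pow, aeval_X,
    Int.cast_natCast, Nat.cast_ite, Nat.cast_one, Nat.cast_zero]
  refine Finset.sum_congr rfl fun i _ => ?_
  split_ifs <;> simp

/-- Membership of a power of `β` in a cyclotomic class is read off its exponent modulo `4`. -/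
theorem pow_mem_Dclass_iff {N f : ℕ} {β : ZMod N} (hβ : orderOf β = 4 * f) (hf : 0 < f)
    {j : ℕ} (hj : j < 4) (m : ℕ) : β ^ m ∈ Dclass N f β j ↔ m % 4 = j := by
  have hfin : IsOfFinOrder β := orderOf_pos_iff.mp (by omega)
  constructor
  · rintro ⟨k, -, hk⟩
    rw [hfin.pow_eq_pow_iff_modEq, hβ] at hk
    have := hk.of_mul_right f
    unfold Nat.ModEq at this
    omega
  · intro hm
    refine ⟨m / 4 % f, Nat.mod_lt _ hf, ?_⟩
    rw [hfin.pow_eq_pow_iff_modEq, hβ]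
    have h := ((Nat.mod_modEq (m / 4) f).mul_left' 4).add_right j
    have hm' : 4 * (m / 4) + j = m := by omega
    rw [hm'] at h
    exact h.symm

theorem exists_pow_eq_of_orderOf_eq {N : ℕ} [Fact N.Prime] {β : ZMod N}
    (hβ : orderOf β = N - 1) {y : ZMod N} (hy : y ≠ 0) : ∃ m, β ^ m = y := by
  have hp : IsPrimitiveRoot β (N - 1) := hβ ▸ IsPrimitiveRoot.orderOf β
  have : NeZero (N - 1) := ⟨by have := (Fact.out : N.Prime).two_le; omega⟩
  obtain ⟨i, -, hi⟩ := hp.eq_pow_of_pow_eq_one (ZMod.pow_card_sub_one_eq_one hy)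
  exact ⟨i, hi⟩

theorem two_ne_zero_zmod {N f : ℕ} (hNf : N = 4 * f + 1) (hf : 0 < f) : (2 : ZMod N) ≠ 0 := by
  intro h
  have h' : ((2 : ℕ) : ZMod N) = 0 := by exact_mod_cast h
  have := Nat.le_of_dvd two_pos ((ZMod.natCast_eq_zero_iff 2 N).mp h')
  omega

/-- If `2` is not a quartic residue, some `2 ^ r` lies in `D_2`. -/
theorem exists_two_pow_eq_pow {N f : ℕ} [Fact N.Prime] {β : ZMod N}
    (hNf : N = 4 * f + 1) (hf : 0 < f) (hβ : orderOf β = N - 1)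
    (h2 : (2 : ZMod N) ∉ Dclass N f β 0) :
    ∃ r e : ℕ, (2 : ZMod N) ^ r = β ^ e ∧ e % 4 = 2 := by
  obtain ⟨m, hm⟩ := exists_pow_eq_of_orderOf_eq hβ (two_ne_zero_zmod hNf hf)
  rw [← hm, pow_mem_Dclass_iff (by omega) hf (by norm_num)] at h2
  by_cases hm2 : m % 4 = 2
  · exact ⟨1, m, by rw [pow_one, hm], hm2⟩
  · exact ⟨2, m * 2, by rw [← hm, pow_mul], by omega⟩

/-- Multiplication by an element of `D_2` exchanges `D_0 ∪ D_1` and `D_2 ∪ D_3`. -/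
theorem pow_mul_mem_iff_notMem {N f : ℕ} [Fact N.Prime]
    {β : ZMod N} (hNf : N = 4 * f + 1) (hf : 0 < f) (hβ : orderOf β = N - 1) {e : ℕ}
    (he : e % 4 = 2) {x : ZMod N} (hx : x ≠ 0) :
    β ^ e * x ∈ {0} ∪ Dclass N f β 0 ∪ Dclass N f β 1 ↔
      x ∉ {0} ∪ Dclass N f β 0 ∪ Dclass N f β 1 := by
  have hβ0 : β ≠ 0 := by
    rintro rfl
    rw [orderOf_zero] at hβ
    omega
  have hβ' : orderOf β = 4 * f := by omega
  obtain ⟨m, rfl⟩ := exists_pow_eq_of_orderOf_eq hβ hx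
  have h0 (n : ℕ) : β ^ n ≠ 0 := pow_ne_zero n hβ0
  simp only [← pow_add, Set.mem_union, Set.mem_singleton_iff, h0, false_or,
    pow_mem_Dclass_iff hβ' hf (show 0 < 4 by norm_num),
    pow_mem_Dclass_iff hβ' hf (show 1 < 4 by norm_num)]
  omega

theorem sum_pow_val_eq_zero {K : Type*} [Field K] {N : ℕ} [NeZero N] {α : K}
    (hα : α ^ N = 1) (h1 : α ≠ 1) : ∑ x : ZMod N, α ^ x.val = 0 := by
  rw [← sum_range_eq_sum_zmod N (fun _ i => α ^ i), geom_sum_eq h1, hα, sub_self, zero_div]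

/-- If multiplication by some `2 ^ r` complements `S` away from `0 ∈ S`, then the sequence
polynomial of `S` vanishes at no `N`-th root of unity. -/
theorem aeval_Spoly_chiSeq_ne_zero {K : Type*} [Field K] [Algebra (ZMod 2) K] [CharP K 2]
    {N f : ℕ} [Fact N.Prime] (hNf : N = 4 * f + 1) (hf : 0 < f) {S : Set (ZMod N)}
    (hS0 : 0 ∈ S) {r : ℕ} (hS : ∀ x ≠ 0, 2 ^ r * x ∈ S ↔ x ∉ S) {α : K} (hα : α ^ N = 1) :
    aeval α (Spoly N (chiSeq N S)) ≠ 0 := by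
  classical
  have hbij : Function.Bijective fun x : ZMod N => 2 ^ r * x :=
    mulLeft_bijective₀ _ (pow_ne_zero r (two_ne_zero_zmod hNf hf))
  have key (x : ZMod N) : ((if 2 ^ r * x ∈ S then 1 else 0) + if x ∈ S then 1 else 0) =
      1 + if x = 0 then 1 else 0 := by
    rcases eq_or_ne x 0 with rfl | hx
    · simp [hS0]
    · by_cases h : x ∈ S <;> simp [hS x hx, h, hx]
  rw [aeval_Spoly_chiSeq]
  rcases eq_or_ne α 1 with rfl | h1
  · have hcard : ∑ x : ZMod N, (if x ∈ S then 1 else 0) = 2 * f + 1 := by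
      have hsum := Finset.sum_congr (rfl : (Finset.univ : Finset (ZMod N)) = _)
        fun x _ => key x
      rw [Finset.sum_add_distrib, Finset.sum_add_distrib,
        hbij.sum_comp (fun x => if x ∈ S then 1 else 0)] at hsum
      simp only [Finset.sum_const, Finset.card_univ, ZMod.card, smul_eq_mul,
        Finset.sum_ite_eq', Finset.mem_univ, if_true] at hsum
      omega
    have hcast := congrArg (Nat.cast : ℕ → K) hcard
    push_cast at hcast
    simp only [one_pow, mul_one, hcast, CharTwo.two_eq_zero, zero_mul, zero_add]
    exact one_ne_zero
  · intro h0
    have hfrob : ∑ x : ZMod N, (if x ∈ S then (1 : K) else 0) * α ^ (2 ^ r * x).val = 0 := by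
      have h := congrArg (· ^ 2 ^ r) h0
      simp only [sum_pow_char_pow 2, zero_pow (pow_ne_zero r two_ne_zero)] at h
      refine (Finset.sum_congr rfl fun x _ => ?_).trans h
      have hval : (2 ^ r * x).val = (x.val * 2 ^ r) % N := by
        rw [← ZMod.val_natCast]
        push_cast
        rw [ZMod.natCast_zmod_val, mul_comm]
      rw [hval, ← pow_eq_pow_mod _ hα, mul_pow, pow_mul]
      split_ifs
      · rw [one_pow]
      · rw [zero_pow (pow_ne_zero r two_ne_zero)]
    have hperm :
        ∑ x : ZMod N, (if 2 ^ r * x ∈ S then (1 : K) else 0) * α ^ (2 ^ r * x).val = 0 :=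
      (hbij.sum_comp fun x => (if x ∈ S then (1 : K) else 0) * α ^ x.val).trans h0
    have hpow : ∑ x : ZMod N, α ^ (2 ^ r * x).val = 0 :=
      (hbij.sum_comp fun x => α ^ x.val).trans (sum_pow_val_eq_zero hα h1)
    have key' (x : ZMod N) := congrArg (Nat.cast : ℕ → K) (key x)
    push_cast at key'
    have h := congrArg₂ (· + ·) hperm hfrob
    simp only [← Finset.sum_add_distrib, ← add_mul, key', add_zero] at h
    simp [add_mul, Finset.sum_add_distrib, hpow] at h

theorem gcd_eq_one_of_isCoprime {p q : (ZMod 2)[X]} (h : IsCoprime p q) :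
    EuclideanDomain.gcd p q = 1 := by
  obtain ⟨c, hc, hc'⟩ := Polynomial.isUnit_iff.mp (EuclideanDomain.gcd_isUnit_iff.mpr h)
  have hc1 : c = 1 := by
    have h01 : ∀ d : ZMod 2, d ≠ 0 → d = 1 := by decide
    exact h01 c hc.ne_zero
  rw [← hc', hc1, C_1]

/-- minimal polynomial and linear complexity of `u'` when `2 ∉ D_0`. -/
theorem stmt11 (N f : ℕ) (hprime : N.Prime) (hNf : N = 4 * f + 1) (hN5 : 5 ≤ N)
    (β : ZMod N) (hβ : orderOf β = N - 1)
    (h2 : (2 : ZMod N) ∉ Dclass N f β 0)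
    (u' : ℤ → ℕ)
    (hu' : u' = chiSeq N ({0} ∪ Dclass N f β 0 ∪ Dclass N f β 1)) :
    EuclideanDomain.gcd (Spoly N u') (X ^ N - 1) = 1 ∧
    (X ^ N - 1) / EuclideanDomain.gcd (Spoly N u') (X ^ N - 1) = X ^ N - 1 ∧
    N - (EuclideanDomain.gcd (Spoly N u') (X ^ N - 1)).natDegree = N := by
  have hf : 0 < f := by omega
  have : Fact N.Prime := ⟨hprime⟩
  have hcop : IsCoprime (Spoly N u') (X ^ N - 1) := by
    rw [isCoprime_iff_aeval_ne_zero_of_isAlgClosed (ZMod 2) (AlgebraicClosure (ZMod 2))]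
    intro α
    by_cases hα : α ^ N = 1
    · left
      have : CharP (AlgebraicClosure (ZMod 2)) 2 := charP_of_injective_algebraMap' (ZMod 2) 2
      rw [hu']
      obtain ⟨r, e, hre, he⟩ := exists_two_pow_eq_pow hNf hf hβ h2
      refine aeval_Spoly_chiSeq_ne_zero hNf hf (by simp) (r := r) (fun x hx => ?_) hα
      rw [hre]
      exact pow_mul_mem_iff_notMem hNf hf hβ he hx
    · right
      simpa [sub_eq_zero] using hα
  have hgcd := gcd_eq_one_of_isCoprime hcop
  rw [hgcd]
  exact ⟨rfl, EuclideanDomain.div_one _, by simp⟩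
end
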